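/- Assume the vertex set I is finite. Then the Fock space representation ρ: 𝔥 → End_K(R) — the unique K-algebra homomorphism with ρ(aᵢ(−m)) = M_{i,m} and ρ(aᵢ(m)) = D_{i,m} for all i ∈ I, m ≥ 1 — is injective. That is, the Fock space representation of the Heisenberg algebra is faithful (the fact used in the paper's proof of its main Theorem that K₀ of the Heisenberg 2-category is isomorphic to the Heisenberg algebra). -/

import Mathlib

/-!
We formalize the quantum Heisenberg algebra `𝔥` associated to a simple graph with vertex
set `I` (in the paper, the affine Dynkin diagram of a nontrivial finite subgroup
`Γ ⊂ SL₂(ℂ)`, `Γ ≠ ℤ/2`), presented over `K = ℚ(t)` by generators `aᵢ(n)` (`i ∈ I`,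
`n ∈ ℤ ∖ {0}`) and the relations
`aᵢ(m)aⱼ(n) = aⱼ(n)aᵢ(m)` for `m + n ≠ 0` and
`aᵢ(-n)aⱼ(n) - aⱼ(n)aᵢ(-n) = κᵢⱼ(n)·1` for `n ≥ 1`, where `κᵢᵢ(n) = -[2n][n]/n`,
`κᵢⱼ(n) = (-1)ⁿ[n]²/n` if `i ∼ j` and `κᵢⱼ(n) = 0` otherwise.
-/

open scoped Classical

set_option synthInstance.maxHeartbeats 1000000

noncomputable section

/-- The base field `K = ℚ(t)`. -/
abbrev K : Type := RatFunc ℚ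

/-- The variable `t ∈ K = ℚ(t)`. -/
def tv : K := RatFunc.X

/-- The quantum integer `[n] = (tⁿ - t⁻ⁿ)/(t - t⁻¹)`. -/
def qint (n : ℤ) : K := (tv ^ n - tv ^ (-n)) / (tv - tv⁻¹)

/-- The quantum integer `[k+1] = t^{-k} + t^{-k+2} + ⋯ + t^{k-2} + t^k`. -/
def qnat (k : ℕ) : K := ∑ j ∈ Finset.range (k + 1), tv ^ (2 * (j : ℤ) - (k : ℤ))

/-- Index type for the generators `aᵢ(n)`, `i ∈ I`, `n ∈ ℤ ∖ {0}`. -/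
abbrev Gen (I : Type) : Type := I × {n : ℤ // n ≠ 0}

/-- The structure constants `κᵢⱼ(n)`:  `κᵢᵢ(n) = -[2n][n]/n`,
`κᵢⱼ(n) = (-1)ⁿ[n]²/n` if `i ∼ j`, and `κᵢⱼ(n) = 0` otherwise. -/
def kappa {I : Type} (G : SimpleGraph I) (i j : I) (n : ℤ) : K :=
  if i = j then -(qint (2 * n) * qint n / (n : K))
  else if G.Adj i j then (-1 : K) ^ n * qint n ^ 2 / (n : K)
  else 0

/-- The defining relations of the Heisenberg algebra:
`aᵢ(m)aⱼ(n) = aⱼ(n)aᵢ(m)` whenever `m + n ≠ 0`, and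
`aᵢ(-n)aⱼ(n) - aⱼ(n)aᵢ(-n) = κᵢⱼ(n)·1` for all `n ≥ 1`. -/
inductive HeisRel {I : Type} (G : SimpleGraph I) :
    FreeAlgebra K (Gen I) → FreeAlgebra K (Gen I) → Prop
  | comm (i j : I) (m n : {k : ℤ // k ≠ 0}) (h : (m : ℤ) + (n : ℤ) ≠ 0) :
      HeisRel G (FreeAlgebra.ι K (i, m) * FreeAlgebra.ι K (j, n))
        (FreeAlgebra.ι K (j, n) * FreeAlgebra.ι K (i, m))
  | heis (i j : I) (n : ℤ) (hn : 1 ≤ n) :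
      HeisRel G
        (FreeAlgebra.ι K (i, ⟨-n, by omega⟩) * FreeAlgebra.ι K (j, ⟨n, by omega⟩) -
          FreeAlgebra.ι K (j, ⟨n, by omega⟩) * FreeAlgebra.ι K (i, ⟨-n, by omega⟩))
        (algebraMap K (FreeAlgebra K (Gen I)) (kappa G i j n))

/-- The Heisenberg algebra `𝔥`, presented by generators and relations. -/
abbrev HeisAlg {I : Type} (G : SimpleGraph I) : Type := RingQuot (HeisRel G)

/-- The generators `aᵢ(n)` of `𝔥` (with the harmless convention `aᵢ(0) = 0`). -/
def aGen {I : Type} (G : SimpleGraph I) (i : I) (n : ℤ) : HeisAlg G :=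
  if h : n ≠ 0 then RingQuot.mkAlgHom K (HeisRel G) (FreeAlgebra.ι K (i, ⟨n, h⟩)) else 0

/-- `p_i^{(n)}` for `n : ℕ`, defined by `p_i^{(0)} = 1` and the recursion
`n·p_i^{(n)} = Σ_{m=1}^{n} (m/[m])·aᵢ(-m)·p_i^{(n-m)}`. -/
def pAux {I : Type} (G : SimpleGraph I) (i : I) : ℕ → HeisAlg G
  | 0 => 1
  | n + 1 =>
      (((n : K) + 1))⁻¹ • ∑ m ∈ Finset.range (n + 1),
        ((((m : K) + 1)) / qint ((m : ℤ) + 1)) •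
          (aGen G i (-((m : ℤ) + 1)) * pAux G i (n - m))
  decreasing_by exact Nat.lt_succ_of_le (Nat.sub_le n m)

/-- `q_i^{(n)}` for `n : ℕ`, defined by `q_i^{(0)} = 1` and the recursion
`n·q_i^{(n)} = Σ_{m=1}^{n} (m/[m])·aᵢ(m)·q_i^{(n-m)}`. -/
def qAux {I : Type} (G : SimpleGraph I) (i : I) : ℕ → HeisAlg G
  | 0 => 1
  | n + 1 =>
      (((n : K) + 1))⁻¹ • ∑ m ∈ Finset.range (n + 1),
        ((((m : K) + 1)) / qint ((m : ℤ) + 1)) •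
          (aGen G i ((m : ℤ) + 1) * qAux G i (n - m))
  decreasing_by exact Nat.lt_succ_of_le (Nat.sub_le n m)

/-- `p_i^{(k)}` for `k : ℤ`, vanishing for `k < 0`. -/
def pH {I : Type} (G : SimpleGraph I) (i : I) (k : ℤ) : HeisAlg G :=
  if k < 0 then 0 else pAux G i k.toNat

/-- `q_i^{(k)}` for `k : ℤ`, vanishing for `k < 0`. -/
def qH {I : Type} (G : SimpleGraph I) (i : I) (k : ℤ) : HeisAlg G :=
  if k < 0 then 0 else qAux G i k.toNat

/-- Index type for the polynomial generators `x_{i,m}`, `i ∈ I`, `m ≥ 1`. -/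
abbrev PIdx (I : Type) : Type := I × {m : ℕ // 1 ≤ m}

/-- The polynomial algebra `R = K[x_{i,m} : i ∈ I, m ≥ 1]`. -/
abbrev FockR (I : Type) : Type := MvPolynomial (PIdx I) K

/-- The constants `λᵢⱼ(m)`: `λᵢᵢ(m) = [2m][m]/m`, `λᵢⱼ(m) = (-1)^{m+1}[m]²/m` if
`i ∼ j`, and `λᵢⱼ(m) = 0` if `i ≠ j` are non-adjacent. -/
def lam {I : Type} (G : SimpleGraph I) (i j : I) (m : ℕ) : K :=
  if i = j then qint (2 * (m : ℤ)) * qint (m : ℤ) / (m : K)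
  else if G.Adj i j then (-1 : K) ^ (m + 1) * qint (m : ℤ) ^ 2 / (m : K)
  else 0

/-- The multiplication operator `M_{i,m}`: multiplication by `x_{i,m}` on `R`. -/
def Mop (I : Type) (i : I) (m : {m : ℕ // 1 ≤ m}) : Module.End K (FockR I) :=
  LinearMap.mulLeft K (MvPolynomial.X (i, m))

/-- The derivation `D_{i,m}` of `R`, the unique `K`-linear derivation with
`D_{i,m}(x_{j,n}) = δ_{m,n}·λᵢⱼ(m)` on the generators. -/
def Dop {I : Type} (G : SimpleGraph I) (i : I) (m : {m : ℕ // 1 ≤ m}) :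
    Module.End K (FockR I) :=
  (MvPolynomial.mkDerivation K fun v : PIdx I =>
    if (v.2 : ℕ) = (m : ℕ) then MvPolynomial.C (lam G i v.1 (m : ℕ)) else 0).toLinearMap

section QuantumIntegers

theorem tv_ne_zero : tv ≠ 0 := RatFunc.X_ne_zero

theorem tv_pow_eq_algebraMap (n : ℕ) :
    tv ^ n = algebraMap (Polynomial ℚ) K (Polynomial.X ^ n) := by
  simp [tv]

theorem tv_pow_ne_one {n : ℕ} (hn : n ≠ 0) : tv ^ n ≠ 1 := by
  intro h
  rw [tv_pow_eq_algebraMap, ← map_one (algebraMap (Polynomial ℚ) K)] at h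
  have h' := congrArg Polynomial.natDegree (RatFunc.algebraMap_injective ℚ h)
  simp [hn] at h'

theorem tv_zpow_sub_zpow_neg_ne_zero {n : ℕ} (hn : n ≠ 0) :
    tv ^ (n : ℤ) - tv ^ (-(n : ℤ)) ≠ 0 := by
  intro h
  have h0 := pow_ne_zero n tv_ne_zero
  rw [zpow_neg, zpow_natCast] at h
  refine tv_pow_ne_one (n := 2 * n) (by omega) ?_
  field_simp at h
  linear_combination h

theorem tv_sub_inv_ne_zero : tv - tv⁻¹ ≠ 0 := by
  simpa using tv_zpow_sub_zpow_neg_ne_zero one_ne_zero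

theorem qint_natCast_ne_zero {n : ℕ} (hn : n ≠ 0) : qint n ≠ 0 :=
  div_ne_zero (tv_zpow_sub_zpow_neg_ne_zero hn) tv_sub_inv_ne_zero

theorem qint_two_mul (n : ℤ) : qint (2 * n) = (tv ^ n + tv ^ (-n)) * qint n := by
  have h1 : tv ^ (2 * n) = tv ^ n * tv ^ n := by rw [two_mul, zpow_add₀ tv_ne_zero]
  have h2 : tv ^ (-(2 * n)) = tv ^ (-n) * tv ^ (-n) := by
    rw [← zpow_add₀ tv_ne_zero]; congr 1; ring
  rw [qint, qint, h1, h2]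
  ring

/-- `tⁿ + t⁻ⁿ` is transcendental over `ℚ`. -/
theorem transcendental_tv_zpow_add {n : ℕ} (hn : n ≠ 0) :
    Transcendental ℚ (tv ^ (n : ℤ) + tv ^ (-(n : ℤ))) := by
  suffices h : ¬∃ c, tv ^ (n : ℤ) + tv ^ (-(n : ℤ)) = RatFunc.C c by
    have e : (DivisionRing.toRatAlgebra : Algebra ℚ K) = RatFunc.instAlgebraOfPolynomial ℚ ℚ :=
      Subsingleton.elim _ _
    rw [e]
    exact RatFunc.transcendental_of_ne_C (K := ℚ) _ h
  rintro ⟨c, hc⟩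
  have h0 := pow_ne_zero n tv_ne_zero
  rw [zpow_neg, zpow_natCast] at hc
  field_simp at hc
  have h : algebraMap (Polynomial ℚ) K (Polynomial.X ^ (n * 2) + 1) =
      algebraMap (Polynomial ℚ) K (Polynomial.C c * Polynomial.X ^ n) := by
    rw [map_add, map_mul, map_one, ← tv_pow_eq_algebraMap, ← tv_pow_eq_algebraMap,
      RatFunc.algebraMap_C]
    linear_combination hc
  have h' := congrArg (fun p => Polynomial.coeff p (n * 2)) (RatFunc.algebraMap_injective ℚ h)
  simp [Polynomial.coeff_X_pow, Polynomial.coeff_one, hn] at h'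

end QuantumIntegers

section PairingMatrix

variable {I : Type} (G : SimpleGraph I)

/-- The matrix of the constants `λᵢⱼ(m)` for fixed `m`. -/
def lamMatrix (m : ℕ) : Matrix I I K := Matrix.of fun i j => lam G i j m

theorem lam_comm (i j : I) (m : ℕ) : lam G i j m = lam G j i m := by
  simp only [lam, G.adj_comm i j, eq_comm (a := i)]

theorem kappa_natCast (i j : I) (m : ℕ) : kappa G i j m = -lam G i j m := by
  simp only [kappa, lam]
  split_ifs <;> simp [pow_succ, neg_div]

variable [Fintype I]

theorem lamMatrix_eq (m : ℕ) :
    lamMatrix G m = (qint m ^ 2 / (m : K)) •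
      (Matrix.scalar I (tv ^ (m : ℤ) + tv ^ (-(m : ℤ))) -
        ((-1 : ℚ) ^ m • G.adjMatrix ℚ).map (algebraMap ℚ K)) := by
  ext i j
  by_cases h : i = j
  · subst h
    simp [lamMatrix, lam, qint_two_mul]
    ring
  · by_cases h' : G.Adj i j <;> simp [lamMatrix, lam, h, h', pow_succ]
    ring

theorem isUnit_det_lamMatrix {m : ℕ} (hm : m ≠ 0) : IsUnit (lamMatrix G m).det := by
  rw [lamMatrix_eq, Matrix.det_smul, ← Matrix.eval_charpoly, Matrix.charpoly_map,
    Polynomial.eval_map_algebraMap, isUnit_iff_ne_zero]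
  refine mul_ne_zero (pow_ne_zero _ (div_ne_zero (pow_ne_zero _ (qint_natCast_ne_zero hm))
    (Nat.cast_ne_zero.mpr hm))) fun h => ?_
  exact transcendental_tv_zpow_add hm ⟨_, (Matrix.charpoly_monic _).ne_zero, h⟩

end PairingMatrix

section Weyl

open MvPolynomial

open scoped IsMulCommutative in
/-- A commuting family in a possibly noncommutative algebra extends to a homomorphism from the
polynomial algebra. -/
theorem MvPolynomial.exists_algHom_of_commute {k A σ : Type*} [CommRing k] [Ring A] [Algebra k A]
    (b : σ → A) (hb : ∀ v w, Commute (b v) (b w)) :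
    ∃ φ : MvPolynomial σ k →ₐ[k] A, ∀ v, φ (X v) = b v := by
  have : IsMulCommutative (Algebra.adjoin k (Set.range b)) :=
      Algebra.isMulCommutative_adjoin k <| by
    rintro _ ⟨v, rfl⟩ _ ⟨w, rfl⟩
    exact hb v w
  refine ⟨(Algebra.adjoin k (Set.range b)).val.comp
    (aeval fun v => ⟨b v, Algebra.subset_adjoin (Set.mem_range_self v)⟩), fun v => ?_⟩
  simp

/-- Canonical commutation relations on generators give the commutation of a generator of the
`Q`-part with an arbitrary element of the `P`-part. -/
theorem MvPolynomial.mul_map_eq_of_commutator {k A σ : Type*} [CommRing k] [Ring A] [Algebra k A]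
    [DecidableEq σ] {P : MvPolynomial σ k →ₐ[k] A} {v : σ} {b : A}
    (h : ∀ w, b * P (X w) = P (X w) * b + if v = w then 1 else 0) (f : MvPolynomial σ k) :
    b * P f = P f * b + P (pderiv v f) := by
  induction f using MvPolynomial.induction_on with
  | C a =>
    have : P (C a) = algebraMap k A a := P.commutes a
    simp [this, Algebra.commutes]
  | add f g hf hg => simp only [map_add, mul_add, add_mul, hf, hg]; abel
  | mul_X f w hf =>
    have hX : P (pderiv v (X w)) = if v = w then 1 else 0 := by
      rw [pderiv_X, Pi.single_apply]
      simp only [eq_comm (a := w), apply_ite P, map_one, map_zero]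
    have h1 : b * (P f * P (X w)) = (b * P f) * P (X w) := (mul_assoc _ _ _).symm
    have h2 : P (X w) * P (pderiv v f) = P (pderiv v f) * P (X w) := by
      rw [← map_mul, ← map_mul, mul_comm]
    simp only [Derivation.leibniz, smul_eq_mul, map_add, map_mul, hX, h1, hf, h2]
    rw [add_mul, mul_assoc, h, mul_add, mul_assoc]
    abel

/-- Applying an iterated partial derivative `∂^γ` to the monomial `x^β`. -/
theorem exists_map_monomial_apply_monomial {k σ : Type*} [Field k] [CharZero k]
    (D : MvPolynomial σ k →ₐ[k] Module.End k (MvPolynomial σ k))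
    (hD : ∀ v f, D (X v) f = pderiv v f) (γ β : σ →₀ ℕ) :
    ∃ c : k, D (monomial γ 1) (monomial β 1) = monomial (β - γ) c ∧ (c ≠ 0 ↔ γ ≤ β) := by
  have hadd : ∀ γ₁ γ₂ : σ →₀ ℕ,
      (∀ β, ∃ c : k, D (monomial γ₁ 1) (monomial β 1) = monomial (β - γ₁) c ∧ (c ≠ 0 ↔ γ₁ ≤ β)) →
      (∀ β, ∃ c : k, D (monomial γ₂ 1) (monomial β 1) = monomial (β - γ₂) c ∧ (c ≠ 0 ↔ γ₂ ≤ β)) →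
      ∀ β, ∃ c : k, D (monomial (γ₁ + γ₂) 1) (monomial β 1) = monomial (β - (γ₁ + γ₂)) c ∧
        (c ≠ 0 ↔ γ₁ + γ₂ ≤ β) := by
    intro γ₁ γ₂ h₁ h₂ β
    obtain ⟨c₂, e₂, n₂⟩ := h₂ β
    obtain ⟨c₁, e₁, n₁⟩ := h₁ (β - γ₂)
    have hm : (monomial (γ₁ + γ₂) 1 : MvPolynomial σ k) = monomial γ₁ 1 * monomial γ₂ 1 := by
      rw [monomial_mul, one_mul]
    have hs : (monomial (β - γ₂) c₂ : MvPolynomial σ k) = c₂ • monomial (β - γ₂) 1 := by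
      rw [smul_monomial, smul_eq_mul, mul_one]
    refine ⟨c₂ * c₁, ?_, ?_⟩
    · rw [hm, map_mul, Module.End.mul_apply, e₂, hs, map_smul, e₁, smul_monomial, smul_eq_mul,
        tsub_add_eq_tsub_tsub_swap]
    · rw [mul_ne_zero_iff, n₁, n₂]
      constructor
      · rintro ⟨h, h'⟩
        exact (le_tsub_iff_right h).mp h'
      · intro h
        have h' : γ₂ ≤ β := le_add_self.trans h
        exact ⟨h', (le_tsub_iff_right h').mpr h⟩
  have hzero : ∀ β, ∃ c : k, D (monomial 0 1) (monomial β 1) = monomial (β - 0) c ∧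
      (c ≠ 0 ↔ 0 ≤ β) := fun β => ⟨1, by simp [← C_apply]⟩
  induction γ using Finsupp.induction_linear generalizing β with
  | zero => exact hzero β
  | add γ₁ γ₂ h₁ h₂ => exact hadd γ₁ γ₂ h₁ h₂ β
  | single v n =>
    induction n generalizing β with
    | zero => simpa using hzero β
    | succ n ih =>
      rw [Finsupp.single_add]
      refine hadd _ _ ih (fun β => ⟨β v, ?_, ?_⟩) β
      · exact (hD v _).trans (by rw [pderiv_monomial, one_mul])
      · rw [Nat.cast_ne_zero, Finsupp.single_le_iff, Nat.one_le_iff_ne_zero]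

/-- The `k`-linear map sending `∑ f_γ y^γ` to the normally ordered `∑ P(f_γ) Q(x^γ)`. -/
def normalOrder {k A σ : Type*} [CommRing k] [Ring A] [Algebra k A]
    (P Q : MvPolynomial σ k →ₐ[k] A) : ((σ →₀ ℕ) →₀ MvPolynomial σ k) →ₗ[k] A :=
  Finsupp.lsum k fun γ => LinearMap.mulRight k (Q (monomial γ 1)) ∘ₗ P.toLinearMap

theorem normalOrder_single {k A σ : Type*} [CommRing k] [Ring A] [Algebra k A]
    (P Q : MvPolynomial σ k →ₐ[k] A) (γ : σ →₀ ℕ) (f : MvPolynomial σ k) :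
    normalOrder P Q (Finsupp.single γ f) = P f * Q (monomial γ 1) := by
  simp [normalOrder]

theorem normalOrder_surjective {k A σ : Type*} [CommRing k] [Ring A] [Algebra k A]
    [DecidableEq σ] (P Q : MvPolynomial σ k →ₐ[k] A)
    (h : ∀ v w, Q (X v) * P (X w) = P (X w) * Q (X v) + if v = w then 1 else 0)
    (hgen : Algebra.adjoin k (Set.range (fun v => P (X v)) ∪ Set.range fun v => Q (X v)) = ⊤) :
    Function.Surjective (normalOrder P Q) := by
  have key : ∀ a : A, ∀ s ∈ LinearMap.range (normalOrder P Q),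
      a * s ∈ LinearMap.range (normalOrder P Q) := by
    intro a
    have ha : a ∈ Algebra.adjoin k (Set.range (fun v => P (X v)) ∪ Set.range fun v => Q (X v)) :=
      hgen ▸ Algebra.mem_top
    induction ha using Algebra.adjoin_induction with
    | mem a ha =>
      rintro _ ⟨F, rfl⟩
      induction F using Finsupp.induction_linear with
      | zero => simp
      | add F G hF hG => rw [map_add, mul_add]; exact add_mem hF hG
      | single γ f =>
        rw [normalOrder_single, ← mul_assoc]
        rcases ha with ⟨v, rfl⟩ | ⟨v, rfl⟩
        · exact ⟨Finsupp.single γ (X v * f), by rw [normalOrder_single, map_mul]⟩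
        · refine ⟨Finsupp.single (Finsupp.single v 1 + γ) f + Finsupp.single γ (pderiv v f), ?_⟩
          have hm : (monomial (Finsupp.single v 1 + γ) 1 : MvPolynomial σ k) =
              X v * monomial γ 1 := by rw [X, monomial_mul, one_mul]
          dsimp only
          rw [mul_map_eq_of_commutator (h v), map_add, normalOrder_single, normalOrder_single, hm,
            map_mul, add_mul, mul_assoc]
    | algebraMap r => intro s hs; rw [← Algebra.smul_def]; exact Submodule.smul_mem _ _ hs
    | add a b _ _ ha hb => intro s hs; rw [add_mul]; exact add_mem (ha s hs) (hb s hs)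
    | mul a b _ _ ha hb => intro s hs; rw [mul_assoc]; exact ha _ (hb s hs)
  intro a
  have := key a 1 ⟨Finsupp.single 0 1, by rw [normalOrder_single]; simp [← C_apply]⟩
  rwa [mul_one] at this

/-- Differential operators in normally ordered form are determined by their action on
polynomials. -/
theorem eq_zero_of_comp_normalOrder_eq_zero {k A σ : Type*} [Field k] [CharZero k] [Ring A]
    [Algebra k A] (P Q : MvPolynomial σ k →ₐ[k] A)
    (ρ : A →ₐ[k] Module.End k (MvPolynomial σ k)) (hP : ∀ f g, ρ (P f) g = f * g)
    (hQ : ∀ v f, ρ (Q (X v)) f = pderiv v f)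
    (F : (σ →₀ ℕ) →₀ MvPolynomial σ k) (hF : ρ (normalOrder P Q F) = 0) : F = 0 := by
  by_contra hne
  obtain ⟨β, hβ, hmin⟩ := F.support.exists_min_image Finsupp.degree
    (Finsupp.support_nonempty_iff.mpr hne)
  have happ := congrArg (fun T => T (monomial β 1)) hF
  simp only [normalOrder, Finsupp.lsum_apply, Finsupp.sum, map_sum, LinearMap.sum_apply,
    LinearMap.comp_apply, LinearMap.mulRight_apply, AlgHom.toLinearMap_apply, map_mul,
    Module.End.mul_apply, hP, LinearMap.zero_apply] at happ
  have hact := exists_map_monomial_apply_monomial (ρ.comp Q) hQ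
  rw [Finset.sum_eq_single_of_mem β hβ] at happ
  · obtain ⟨c, hc, hc'⟩ := hact β β
    rw [AlgHom.comp_apply] at hc
    rw [hc, tsub_self] at happ
    refine (mul_ne_zero (Finsupp.mem_support_iff.mp hβ) ?_) happ
    simpa using hc'.mpr le_rfl
  · intro γ hγ hγβ
    obtain ⟨c, hc, hc'⟩ := hact γ β
    rw [AlgHom.comp_apply] at hc
    have : c = 0 := by
      by_contra h0
      obtain ⟨δ, rfl⟩ := exists_add_of_le (hc'.mp h0)
      have hdeg := hmin γ hγ
      rw [map_add, add_le_iff_nonpos_right, nonpos_iff_eq_zero, Finsupp.degree_eq_zero_iff] at hdeg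
      exact hγβ (by rw [hdeg, add_zero])
    rw [hc, this, map_zero, mul_zero]

/-- A representation of a Weyl algebra on polynomials by multiplications and operators killing `1`
is faithful in characteristic zero. -/
theorem weyl_representation_injective {k A σ : Type*} [Field k] [CharZero k] [Ring A]
    [Algebra k A] [DecidableEq σ] (P Q : MvPolynomial σ k →ₐ[k] A)
    (h : ∀ v w, Q (X v) * P (X w) = P (X w) * Q (X v) + if v = w then 1 else 0)
    (hgen : Algebra.adjoin k (Set.range (fun v => P (X v)) ∪ Set.range fun v => Q (X v)) = ⊤)
    (ρ : A →ₐ[k] Module.End k (MvPolynomial σ k))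
    (hP : ∀ v, ρ (P (X v)) = LinearMap.mulLeft k (X v)) (hQ : ∀ v, ρ (Q (X v)) 1 = 0) :
    Function.Injective ρ := by
  have hP' : ∀ f g, ρ (P f) g = f * g := by
    have : ρ.comp P = Algebra.lmul k (MvPolynomial σ k) := algHom_ext fun v => hP v
    exact fun f g => congrArg (fun φ => φ f g) this
  have hQ' : ∀ v f, ρ (Q (X v)) f = pderiv v f := by
    intro v f
    have := congrArg (fun a => ρ a 1) (mul_map_eq_of_commutator (h v) f)
    simpa [hP', hQ] using this
  rw [injective_iff_map_eq_zero]
  intro a ha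
  obtain ⟨F, rfl⟩ := normalOrder_surjective P Q h hgen a
  rw [eq_zero_of_comp_normalOrder_eq_zero P Q ρ hP' hQ' F ha, map_zero]

end Weyl

section Heisenberg

variable {I : Type} (G : SimpleGraph I)

theorem commute_aGen (i j : I) {m n : ℤ} (h : m + n ≠ 0) :
    Commute (aGen G i m) (aGen G j n) := by
  by_cases hm : m = 0
  · simp [aGen, hm]
  by_cases hn : n = 0
  · simp [aGen, hn]
  have := RingQuot.mkAlgHom_rel K (HeisRel.comm (G := G) i j ⟨m, hm⟩ ⟨n, hn⟩ h)
  simpa [aGen, hm, hn, Commute, SemiconjBy] using this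

theorem aGen_mul_aGen_neg (i j : I) (m : {m : ℕ // 1 ≤ m}) :
    aGen G j (m : ℕ) * aGen G i (-(m : ℕ) : ℤ) =
      aGen G i (-(m : ℕ) : ℤ) * aGen G j (m : ℕ) + algebraMap K _ (lam G j i m) := by
  have hm : ((m : ℕ) : ℤ) ≠ 0 := by have := m.2; omega
  have := RingQuot.mkAlgHom_rel K (HeisRel.heis (G := G) i j (m : ℕ) (by have := m.2; omega))
  rw [map_sub, map_mul, map_mul, AlgHom.commutes, kappa_natCast, map_neg, lam_comm] at this
  rw [aGen, aGen, dif_pos hm, dif_pos (neg_ne_zero.mpr hm), ← sub_eq_iff_eq_add', ← neg_sub, this,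
    neg_neg]

theorem adjoin_range_aGen :
    Algebra.adjoin K (Set.range fun v : Gen I => aGen G v.1 v.2) = ⊤ := by
  have h : (fun v : Gen I => aGen G v.1 v.2) =
      RingQuot.mkAlgHom K (HeisRel G) ∘ FreeAlgebra.ι K := by
    funext v
    simp [aGen, v.2.2]
  rw [h, Set.range_comp, ← AlgHom.map_adjoin, FreeAlgebra.adjoin_range_ι, Algebra.map_top,
    AlgHom.range_eq_top]
  exact RingQuot.mkAlgHom_surjective K _

variable [Fintype I]

/-- The element `∑ₖ (λ(m)⁻¹)_{jk} aₖ(m)`, dual to `a_j(-m)`. -/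
def dualGen (v : PIdx I) : HeisAlg G :=
  ∑ k, (lamMatrix G v.2)⁻¹ v.1 k • aGen G k ((v.2 : ℕ) : ℤ)

theorem commute_dualGen (v w : PIdx I) : Commute (dualGen G v) (dualGen G w) :=
  Commute.sum_left _ _ _ fun i _ => Commute.sum_right _ _ _ fun j _ =>
    ((commute_aGen G i j (by have := v.2.2; omega)).smul_left _).smul_right _

theorem dualGen_mul_aGen_neg (v w : PIdx I) :
    dualGen G v * aGen G w.1 (-(w.2 : ℕ) : ℤ) =
      aGen G w.1 (-(w.2 : ℕ) : ℤ) * dualGen G v + if v = w then 1 else 0 := by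
  obtain ⟨j, m⟩ := v
  obtain ⟨i, n⟩ := w
  by_cases hmn : m = n
  · subst hmn
    have hinv := congrFun (congrFun (Matrix.nonsing_inv_mul (lamMatrix G m)
      (isUnit_det_lamMatrix G (Nat.one_le_iff_ne_zero.mp m.2))) j) i
    rw [Matrix.mul_apply, Matrix.one_apply] at hinv
    have hsum := congrArg (algebraMap K (HeisAlg G)) hinv
    simp only [map_sum, map_mul, apply_ite (algebraMap K (HeisAlg G)), map_one, map_zero] at hsum
    simp only [dualGen, Finset.sum_mul, Finset.mul_sum, smul_mul_assoc, mul_smul_comm,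
      aGen_mul_aGen_neg, smul_add, Finset.sum_add_distrib, Prod.mk.injEq, and_true, ← hsum]
    congr 1
  · rw [if_neg (by simp [hmn]), add_zero]
    refine Commute.sum_left _ _ _ fun k _ => (commute_aGen G k i ?_).smul_left _
    have : (m : ℕ) ≠ n := fun h => hmn (Subtype.ext h)
    change (m : ℤ) + -(n : ℤ) ≠ 0
    omega

theorem aGen_eq_sum_dualGen (i : I) (m : {m : ℕ // 1 ≤ m}) :
    aGen G i (m : ℕ) = ∑ j, lamMatrix G m i j • dualGen G (j, m) := by
  have hinv := Matrix.mul_nonsing_inv (lamMatrix G m)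
    (isUnit_det_lamMatrix G (Nat.one_le_iff_ne_zero.mp m.2))
  simp only [dualGen, Finset.smul_sum, smul_smul]
  rw [Finset.sum_comm]
  simp only [← Finset.sum_smul, ← Matrix.mul_apply, hinv, Matrix.one_apply, ite_smul, one_smul,
    zero_smul, Finset.sum_ite_eq, Finset.mem_univ, if_true]

theorem adjoin_aGen_neg_union_dualGen :
    Algebra.adjoin K ((Set.range fun v : PIdx I => aGen G v.1 (-(v.2 : ℕ) : ℤ)) ∪
      Set.range (dualGen G)) = ⊤ := by
  rw [eq_top_iff, ← adjoin_range_aGen, Algebra.adjoin_le_iff]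
  rintro _ ⟨⟨i, n, hn⟩, rfl⟩
  obtain ⟨m, rfl | rfl⟩ := n.eq_nat_or_neg
  · have hm : 1 ≤ m := by omega
    dsimp only
    rw [aGen_eq_sum_dualGen G i ⟨m, hm⟩]
    refine Subalgebra.sum_mem _ fun j _ => Subalgebra.smul_mem _ (Algebra.subset_adjoin ?_) _
    exact Or.inr ⟨(j, ⟨m, hm⟩), rfl⟩
  · exact Algebra.subset_adjoin (Or.inl ⟨(i, ⟨m, by omega⟩), rfl⟩)

end Heisenberg

/-- faithfulness of the Fock space representation: if the vertex set
`I` is finite, then the unique `K`-algebra homomorphism `ρ : 𝔥 → End_K(R)` with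
`ρ(aᵢ(-m)) = M_{i,m}` and `ρ(aᵢ(m)) = D_{i,m}` (for all `i ∈ I`, `m ≥ 1`) is
injective. -/
theorem heisenberg_fock_representation_faithful {I : Type} [Finite I]
    (G : SimpleGraph I) (ρ : HeisAlg G →ₐ[K] Module.End K (FockR I))
    (hρ : ∀ (i : I) (m : {m : ℕ // 1 ≤ m}),
      ρ (aGen G i (-(m : ℕ) : ℤ)) = Mop I i m ∧
      ρ (aGen G i ((m : ℕ) : ℤ)) = Dop G i m) :
    Function.Injective ρ := by
  have := Fintype.ofFinite I
  obtain ⟨P, hP⟩ := MvPolynomial.exists_algHom_of_commute (k := K)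
    (fun v : PIdx I => aGen G v.1 (-(v.2 : ℕ) : ℤ))
    fun v w => commute_aGen G v.1 w.1 (by have := v.2.2; omega)
  obtain ⟨Q, hQ⟩ := MvPolynomial.exists_algHom_of_commute (k := K) (dualGen G)
    (commute_dualGen G)
  refine weyl_representation_injective P Q (fun v w => ?_) ?_ ρ (fun v => ?_) fun v => ?_
  · rw [hP, hQ]
    exact dualGen_mul_aGen_neg G v w
  · simp only [hP, hQ]
    exact adjoin_aGen_neg_union_dualGen G
  · rw [hP]
    exact (hρ v.1 v.2).1
  · simp [hQ, dualGen, (hρ _ v.2).2, Dop]
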